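/- Suppose Assumption (xc-bound) holds with constant θ, and UWP holds with a constant δ such that b₁ := 1 − (‖L†‖₂ + θ)/δ > 0. Let {V^i} be generated by the simple mixing scheme V^{i+1} = V^i − α (V^i − 𝒱(F_φ(V^i))) with a step size α satisfying 0 < α < 2/(2 − b₁). Then {V^i} converges to a point V* solving V* = 𝒱(F_φ(V*)) (a solution of the KS equation), with linear convergence rate no more than |1−α| + α(1−b₁) < 1; that is, ‖V^{i+1} − V*‖₂ ≤ (|1−α| + α(1−b₁)) ‖V^i − V*‖₂ for all i. -/

import Mathlib

open Matrix Filter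

/-- Euclidean (ℓ²) norm of a vector in `Fin n → ℝ`. -/
noncomputable def vnorm {n : ℕ} (v : Fin n → ℝ) : ℝ := Real.sqrt (∑ i, v i ^ 2)

/-- Spectral (ℓ² operator) norm of a real matrix. -/
noncomputable def specNorm {m k : ℕ} (A : Matrix (Fin m) (Fin k) ℝ) : ℝ :=
  ‖LinearMap.toContinuousLinearMap (Matrix.toEuclideanLin A)‖

/-- Eigenvalues of a real symmetric matrix, sorted in ascending order
(junk value `0` if the matrix is not symmetric). -/
noncomputable def eig {n : ℕ} (A : Matrix (Fin n) (Fin n) ℝ) : Fin n → ℝ :=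
  if h : A.IsHermitian then h.eigenvalues ∘ (Tuple.sort h.eigenvalues) else 0

/-- Orthogonal spectral projector onto the invariant subspace spanned by eigenvectors
associated with the `p` smallest eigenvalues of a symmetric matrix. -/
noncomputable def specProj {n : ℕ} (p : ℕ) (A : Matrix (Fin n) (Fin n) ℝ) :
    Matrix (Fin n) (Fin n) ℝ :=
  if h : A.IsHermitian then
    (h.eigenvectorUnitary : Matrix (Fin n) (Fin n) ℝ) *
      Matrix.diagonal (fun k => if (((Tuple.sort h.eigenvalues).symm k : Fin n) : ℕ) < p
        then (1 : ℝ) else 0) *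
      star (h.eigenvectorUnitary : Matrix (Fin n) (Fin n) ℝ)
  else 0

/-- The Hamiltonian `H(V) = (1/2)L + V_ion + Diag(V)`. -/
noncomputable def Hmat {n : ℕ} (L Vion : Matrix (Fin n) (Fin n) ℝ) (V : Fin n → ℝ) :
    Matrix (Fin n) (Fin n) ℝ :=
  (1 / 2 : ℝ) • L + Vion + Matrix.diagonal V

/-- `F_φ(V) = diag(P_p(V))`. -/
noncomputable def Fphi {n : ℕ} (p : ℕ) (L Vion : Matrix (Fin n) (Fin n) ℝ) (V : Fin n → ℝ) :
    Fin n → ℝ :=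
  fun i => specProj p (Hmat L Vion V) i i

/-- The potential map `𝒱(ρ) = L†ρ + μ_xc(ρ)ᵀe`, with `m ρ = μ_xc(ρ)ᵀe`. -/
noncomputable def potMap {n : ℕ} (Ld : Matrix (Fin n) (Fin n) ℝ)
    (m : (Fin n → ℝ) → (Fin n → ℝ)) (ρ : Fin n → ℝ) : Fin n → ℝ :=
  Ld.mulVec ρ + m ρ

/-- A diagonal entry of a symmetric idempotent real matrix lies in `[0, 1]`. -/
theorem diag_mem_Icc_of_isSymm_of_isIdempotent {n : ℕ} {M : Matrix (Fin n) (Fin n) ℝ}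
    (hs : Mᵀ = M) (hi : M * M = M) (k : Fin n) : M k k ∈ Set.Icc (0 : ℝ) 1 := by
  have h1 : M k k = ∑ j, M k j ^ 2 := by
    conv_lhs => rw [← hi, Matrix.mul_apply]
    refine Finset.sum_congr rfl fun j _ => ?_
    rw [sq, ← congrFun (congrFun hs k) j, Matrix.transpose_apply]
  have h2 : M k k ^ 2 ≤ M k k := by
    conv_rhs => rw [h1]
    exact Finset.single_le_sum (f := fun j => M k j ^ 2) (fun j _ => sq_nonneg _)
      (Finset.mem_univ k)
  constructor <;> nlinarith

theorem sum_diag_sq_le_trace_mul_self {n : ℕ} {X : Matrix (Fin n) (Fin n) ℝ} (hs : Xᵀ = X) :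
    ∑ i, X i i ^ 2 ≤ (X * X).trace := by
  refine Finset.sum_le_sum fun i _ => ?_
  have h1 : (X * X) i i = ∑ j, X i j ^ 2 := by
    rw [Matrix.mul_apply]
    refine Finset.sum_congr rfl fun j _ => ?_
    rw [sq, ← congrFun (congrFun hs i) j, Matrix.transpose_apply]
  rw [Matrix.diag_apply, h1]
  exact Finset.single_le_sum (f := fun j => X i j ^ 2) (fun j _ => sq_nonneg _)
    (Finset.mem_univ i)

theorem specProj_transpose {n : ℕ} (p : ℕ) (A : Matrix (Fin n) (Fin n) ℝ) :
    (specProj p A)ᵀ = specProj p A := by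
  unfold specProj
  split_ifs with h
  · simp [Matrix.star_eq_conjTranspose, Matrix.conjTranspose_eq_transpose_of_trivial,
      Matrix.mul_assoc]
  · simp

theorem specProj_mul_self {n : ℕ} (p : ℕ) (A : Matrix (Fin n) (Fin n) ℝ) :
    specProj p A * specProj p A = specProj p A := by
  unfold specProj
  split_ifs with h
  · set U := (h.eigenvectorUnitary : Matrix (Fin n) (Fin n) ℝ)
    have hU : star U * U = 1 := Unitary.coe_star_mul_self h.eigenvectorUnitary
    set D := Matrix.diagonal (fun k => if (((Tuple.sort h.eigenvalues).symm k : Fin n) : ℕ) < p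
        then (1 : ℝ) else 0) with hD
    have hDD : D * D = D := by simp [hD]
    calc U * D * star U * (U * D * star U) = U * D * (star U * U) * D * star U := by
          simp only [Matrix.mul_assoc]
      _ = U * D * star U := by rw [hU, Matrix.mul_one, Matrix.mul_assoc U D D, hDD]
  · simp

theorem trace_specProj {n : ℕ} (p : ℕ) {A : Matrix (Fin n) (Fin n) ℝ} (hA : A.IsHermitian) :
    (specProj p A).trace = ∑ j : Fin n, if (j : ℕ) < p then (1 : ℝ) else 0 := by
  rw [specProj, dif_pos hA, Matrix.mul_assoc, Matrix.trace_mul_comm, Matrix.mul_assoc,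
    Unitary.coe_star_mul_self, Matrix.mul_one, Matrix.trace_diagonal]
  exact Equiv.sum_comp (Tuple.sort hA.eigenvalues).symm
    (fun j : Fin n => if (j : ℕ) < p then (1 : ℝ) else 0)

/-- The spectral projector minimizes `Q ↦ tr (A Q)` among orthogonal projectors of the same rank,
with quadratic growth governed by the spectral gap. -/
theorem gap_mul_le_trace_mul_sub {n p : ℕ} (hp : p - 1 < n) (hpn : p < n) {δ : ℝ}
    {A Q : Matrix (Fin n) (Fin n) ℝ} (hA : A.IsHermitian)
    (hgap : eig A ⟨p, hpn⟩ - eig A ⟨p - 1, hp⟩ ≥ δ)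
    (hs : Qᵀ = Q) (hi : Q * Q = Q) (htr : Q.trace = (specProj p A).trace) :
    δ * (Q.trace - (specProj p A * Q).trace) ≤ (A * Q).trace - (A * specProj p A).trace := by
  rw [trace_specProj p hA] at htr
  simp only [eig, dif_pos hA, Function.comp] at hgap
  rw [specProj, dif_pos hA]
  set U := (hA.eigenvectorUnitary : Matrix (Fin n) (Fin n) ℝ)
  have hU : star U * U = 1 := Unitary.coe_star_mul_self hA.eigenvectorUnitary
  have hU' : U * star U = 1 := Unitary.coe_mul_star_self hA.eigenvectorUnitary
  set σ := Tuple.sort hA.eigenvalues with hσ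
  have hmono : Monotone (hA.eigenvalues ∘ σ) := Tuple.monotone_sort _
  set l := hA.eigenvalues with hl
  set c : Fin n → ℝ := fun k => if ((σ.symm k : Fin n) : ℕ) < p then (1 : ℝ) else 0 with hc
  have hspec : A = U * Matrix.diagonal l * star U := by
    have := hA.spectral_theorem
    rw [Unitary.conjStarAlgAut_apply] at this
    simpa using this
  set M := star U * Q * U with hM
  have hMs : Mᵀ = M := by
    simp [hM, Matrix.star_eq_conjTranspose, Matrix.conjTranspose_eq_transpose_of_trivial,
      Matrix.mul_assoc, hs]
  have hMi : M * M = M := by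
    calc M * M = star U * Q * (U * star U) * Q * U := by simp only [hM, Matrix.mul_assoc]
      _ = M := by rw [hU', Matrix.mul_one, Matrix.mul_assoc (star U) Q Q, hi]
  have htrace (d : Fin n → ℝ) : (U * Matrix.diagonal d * star U * Q).trace = ∑ k, d k * M k k := by
    rw [Matrix.mul_assoc, Matrix.mul_assoc, Matrix.trace_mul_comm, Matrix.mul_assoc]
    simp [Matrix.trace, hM]
  have htrQ : Q.trace = ∑ k, M k k := by
    have := htrace 1
    simpa [hU'] using this
  have htrP : (A * (U * Matrix.diagonal c * star U)).trace = ∑ k, l k * c k := by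
    have : A * (U * Matrix.diagonal c * star U)
        = U * (Matrix.diagonal l * Matrix.diagonal c * star U) := by
      conv_lhs => rw [hspec]
      calc _ = U * Matrix.diagonal l * (star U * U) * Matrix.diagonal c * star U := by
            simp only [Matrix.mul_assoc]
        _ = _ := by rw [hU]; simp only [Matrix.mul_assoc, Matrix.mul_one]
    rw [this, Matrix.trace_mul_comm, Matrix.mul_assoc, hU, Matrix.mul_one,
      Matrix.diagonal_mul_diagonal, Matrix.trace_diagonal]
  have htrA : (A * Q).trace = ∑ k, l k * M k k := by rw [← htrace, ← hspec]
  have hcsum : ∑ k, c k = ∑ k, M k k := by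
    rw [← htrQ, htr]
    exact Equiv.sum_comp σ.symm (fun j : Fin n => if (j : ℕ) < p then (1 : ℝ) else 0)
  rw [htrace, htrQ, htrP, htrA]
  set ν := l (σ ⟨p - 1, hp⟩) with hν
  have hshift : ∑ k, l k * M k k - ∑ k, l k * c k = ∑ k, (l k - ν) * (M k k - c k) := by
    have : ∑ k, (l k - ν) * (M k k - c k)
        = (∑ k, l k * M k k - ∑ k, l k * c k) - ν * (∑ k, M k k - ∑ k, c k) := by
      rw [← Finset.sum_sub_distrib, ← Finset.sum_sub_distrib, Finset.mul_sum,
        ← Finset.sum_sub_distrib]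
      exact Finset.sum_congr rfl fun k _ => by ring
    rw [this, hcsum]; ring
  rw [hshift, ← Finset.sum_sub_distrib, Finset.mul_sum]
  refine Finset.sum_le_sum fun k _ => ?_
  obtain ⟨h0, h1⟩ := diag_mem_Icc_of_isSymm_of_isIdempotent hMs hMi k
  by_cases hk : ((σ.symm k : Fin n) : ℕ) < p
  · have hle : l k ≤ ν := by
      have := @hmono (σ.symm k) ⟨p - 1, hp⟩ (by rw [Fin.le_def]; simp only; omega)
      simpa using this
    simp only [hc, hk, if_true]
    nlinarith
  · have hge : l (σ ⟨p, hpn⟩) ≤ l k := by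
      have := @hmono ⟨p, hpn⟩ (σ.symm k) (by rw [Fin.le_def]; simp only; omega)
      simpa using this
    simp only [hc, hk, if_false]
    nlinarith

theorem Hmat_isHermitian {n : ℕ} {L Vion : Matrix (Fin n) (Fin n) ℝ} (hL : L.IsHermitian)
    (hVion : Vion.IsHermitian) (V : Fin n → ℝ) : (Hmat L Vion V).IsHermitian := by
  refine Matrix.IsHermitian.add (Matrix.IsHermitian.add ?_ hVion)
    (Matrix.isHermitian_diagonal V)
  rw [Matrix.IsHermitian, Matrix.conjTranspose_smul, hL.eq]
  simp

theorem vnorm_eq_norm_toLp {n : ℕ} (v : Fin n → ℝ) : vnorm v = ‖WithLp.toLp 2 v‖ := by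
  simp [vnorm, EuclideanSpace.norm_eq]

theorem vnorm_sq {n : ℕ} (v : Fin n → ℝ) : vnorm v ^ 2 = ∑ i, v i ^ 2 :=
  Real.sq_sqrt (Finset.sum_nonneg fun _ _ => sq_nonneg _)

theorem vnorm_nonneg {n : ℕ} (v : Fin n → ℝ) : 0 ≤ vnorm v := Real.sqrt_nonneg _

theorem sum_mul_le_vnorm_mul_vnorm {n : ℕ} (v w : Fin n → ℝ) :
    ∑ i, v i * w i ≤ vnorm v * vnorm w :=
  Real.sum_mul_le_sqrt_mul_sqrt _ _ _

theorem vnorm_add_le {n : ℕ} (v w : Fin n → ℝ) : vnorm (v + w) ≤ vnorm v + vnorm w := by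
  simp only [vnorm_eq_norm_toLp, WithLp.toLp_add]
  exact norm_add_le _ _

theorem vnorm_smul {n : ℕ} (a : ℝ) (v : Fin n → ℝ) : vnorm (a • v) = |a| * vnorm v := by
  simp only [vnorm_eq_norm_toLp, WithLp.toLp_smul, norm_smul, Real.norm_eq_abs]

theorem vnorm_mulVec_le {n : ℕ} (A : Matrix (Fin n) (Fin n) ℝ) (v : Fin n → ℝ) :
    vnorm (A *ᵥ v) ≤ specNorm A * vnorm v := by
  simp only [vnorm_eq_norm_toLp, specNorm]
  exact (LinearMap.toContinuousLinearMap (Matrix.toEuclideanLin A)).le_opNorm (WithLp.toLp 2 v)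

/-- Under uniform well-posedness, `F_φ` is Lipschitz with constant `1 / δ`. -/
theorem gap_mul_vnorm_Fphi_sub_le {n p : ℕ} (hp : p - 1 < n) (hpn : p < n)
    {L Vion : Matrix (Fin n) (Fin n) ℝ} (hL : L.IsHermitian) (hVion : Vion.IsHermitian)
    {δ : ℝ} (hδ : 0 < δ)
    (hUWP : ∀ W : Fin n → ℝ,
      eig (Hmat L Vion W) ⟨p, hpn⟩ - eig (Hmat L Vion W) ⟨p - 1, hp⟩ ≥ δ)
    (V W : Fin n → ℝ) :
    δ * vnorm (Fphi p L Vion V - Fphi p L Vion W) ≤ vnorm (V - W) := by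
  have hA := Hmat_isHermitian hL hVion V
  have hB := Hmat_isHermitian hL hVion W
  set A := Hmat L Vion V with hAdef
  set B := Hmat L Vion W with hBdef
  set P := specProj p A with hP
  set Q := specProj p B with hQ
  have hPs : Pᵀ = P := specProj_transpose p A
  have hQs : Qᵀ = Q := specProj_transpose p B
  have hPi : P * P = P := specProj_mul_self p A
  have hQi : Q * Q = Q := specProj_mul_self p B
  have htr : Q.trace = P.trace := by rw [hP, hQ, trace_specProj p hA, trace_specProj p hB]
  have h1 := gap_mul_le_trace_mul_sub hp hpn hA (hUWP V) hQs hQi htr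
  have h2 := gap_mul_le_trace_mul_sub hp hpn hB (hUWP W) hPs hPi htr.symm
  rw [← hP] at h1
  rw [← hQ, Matrix.trace_mul_comm Q P] at h2
  have h3 : ∑ i, (P - Q) i i ^ 2 ≤ ((P - Q) * (P - Q)).trace :=
    sum_diag_sq_le_trace_mul_self (by rw [Matrix.transpose_sub, hPs, hQs])
  have h4 : ((P - Q) * (P - Q)).trace = P.trace - (P * Q).trace + (Q.trace - (P * Q).trace) := by
    rw [Matrix.sub_mul, Matrix.mul_sub, Matrix.mul_sub, hPi, hQi]
    simp only [Matrix.trace_sub]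
    rw [Matrix.trace_mul_comm Q P]; ring
  have h5 : (A * Q).trace - (A * P).trace + ((B * P).trace - (B * Q).trace)
      = ∑ i, (W - V) i * (Fphi p L Vion V - Fphi p L Vion W) i := by
    have hsub : B - A = Matrix.diagonal (W - V) := by
      rw [hAdef, hBdef, Hmat, Hmat, add_sub_add_left_eq_sub, Matrix.diagonal_sub]; rfl
    have : ((B - A) * (P - Q)).trace
        = (A * Q).trace - (A * P).trace + ((B * P).trace - (B * Q).trace) := by
      simp only [Matrix.sub_mul, Matrix.mul_sub, Matrix.trace_sub]; ring
    rw [← this, hsub, Matrix.trace]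
    refine Finset.sum_congr rfl fun i _ => ?_
    rw [Matrix.diag_apply, Matrix.diagonal_mul]; rfl
  have h6 : vnorm (Fphi p L Vion V - Fphi p L Vion W) ^ 2 ≤ ((P - Q) * (P - Q)).trace := by
    rw [vnorm_sq]; exact h3
  have h7 := sum_mul_le_vnorm_mul_vnorm (W - V) (Fphi p L Vion V - Fphi p L Vion W)
  have h8 : vnorm (W - V) = vnorm (V - W) := by
    rw [← neg_sub V W, ← neg_one_smul ℝ, vnorm_smul]; simp
  rw [h8] at h7
  set f := vnorm (Fphi p L Vion V - Fphi p L Vion W) with hf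
  have hf0 : 0 ≤ f := vnorm_nonneg _
  have h9 : (δ * f) * f ≤ vnorm (V - W) * f := by
    have := mul_le_mul_of_nonneg_left h6 hδ.le
    nlinarith
  rcases hf0.eq_or_lt with h | h
  · rw [← h, mul_zero]; exact vnorm_nonneg _
  · exact le_of_mul_le_mul_right h9 h

/-- Mean value inequality for the Euclidean norm on `Fin n → ℝ`. -/
theorem vnorm_sub_le_of_vnorm_fderiv_le {n : ℕ} {m : (Fin n → ℝ) → (Fin n → ℝ)} {θ : ℝ}
    (hm : Differentiable ℝ m) (hθ : 0 ≤ θ)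
    (hmθ : ∀ ρ z : Fin n → ℝ, vnorm (fderiv ℝ m ρ z) ≤ θ * vnorm z) (x y : Fin n → ℝ) :
    vnorm (m x - m y) ≤ θ * vnorm (x - y) := by
  let e := EuclideanSpace.equiv (Fin n) ℝ
  let g : EuclideanSpace ℝ (Fin n) → EuclideanSpace ℝ (Fin n) := fun u => e.symm (m (e u))
  have hg (u : EuclideanSpace ℝ (Fin n)) : HasFDerivAt g
      ((e.symm : (Fin n → ℝ) →L[ℝ] _).comp ((fderiv ℝ m (e u)).comp (e : _ →L[ℝ] _))) u :=
    e.symm.hasFDerivAt.comp u ((hm (e u)).hasFDerivAt.comp u e.hasFDerivAt)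
  have := Convex.norm_image_sub_le_of_norm_hasFDerivWithin_le (𝕜 := ℝ) (f := g) (C := θ)
    (s := Set.univ) (x := WithLp.toLp 2 y) (y := WithLp.toLp 2 x)
    (fun u _ => (hg u).hasFDerivWithinAt)
    (fun u _ => ContinuousLinearMap.opNorm_le_bound _ hθ fun z => by
      have h := hmθ (e u) (e z)
      rw [vnorm_eq_norm_toLp, vnorm_eq_norm_toLp] at h
      exact h) convex_univ (Set.mem_univ _) (Set.mem_univ _)
  rw [vnorm_eq_norm_toLp, vnorm_eq_norm_toLp]
  exact this

/-- A self-map of `Fin n → ℝ` that contracts the Euclidean norm has a fixed point. -/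
theorem exists_fixedPoint_of_vnorm_contraction {n : ℕ} {T : (Fin n → ℝ) → (Fin n → ℝ)} {K : ℝ}
    (hK0 : 0 ≤ K) (hK1 : K < 1) (hT : ∀ x y, vnorm (T x - T y) ≤ K * vnorm (x - y)) :
    ∃ x, x = T x := by
  let S : EuclideanSpace ℝ (Fin n) → EuclideanSpace ℝ (Fin n) :=
    fun u => WithLp.toLp 2 (T (WithLp.ofLp u))
  have hS : ContractingWith ⟨K, hK0⟩ S := by
    refine ⟨by exact_mod_cast hK1, LipschitzWith.of_dist_le_mul fun u v => ?_⟩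
    have h := hT (WithLp.ofLp u) (WithLp.ofLp v)
    rw [vnorm_eq_norm_toLp, vnorm_eq_norm_toLp] at h
    rw [dist_eq_norm, dist_eq_norm]
    exact h
  refine ⟨WithLp.ofLp hS.fixedPoint, ?_⟩
  conv_lhs => rw [← hS.fixedPoint_isFixedPt.eq]

theorem tendsto_of_vnorm_sub_le_geometric {n : ℕ} {V : ℕ → Fin n → ℝ} {v : Fin n → ℝ} {r : ℝ}
    (hr0 : 0 ≤ r) (hr1 : r < 1) (h : ∀ i, vnorm (V (i + 1) - v) ≤ r * vnorm (V i - v)) :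
    Tendsto V atTop (nhds v) := by
  have hpow (i : ℕ) : vnorm (V i - v) ≤ r ^ i * vnorm (V 0 - v) := by
    induction i with
    | zero => simp
    | succ i ih =>
      calc vnorm (V (i + 1) - v) ≤ r * vnorm (V i - v) := h i
        _ ≤ r * (r ^ i * vnorm (V 0 - v)) := mul_le_mul_of_nonneg_left ih hr0
        _ = r ^ (i + 1) * vnorm (V 0 - v) := by ring
  have hlim : Tendsto (fun i => r ^ i * vnorm (V 0 - v)) atTop (nhds 0) := by
    simpa using (tendsto_pow_atTop_nhds_zero_of_lt_one hr0 hr1).mul_const (vnorm (V 0 - v))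
  have hE : Tendsto (fun i => WithLp.toLp 2 (V i)) atTop (nhds (WithLp.toLp 2 v)) := by
    rw [tendsto_iff_norm_sub_tendsto_zero]
    refine squeeze_zero (fun _ => norm_nonneg _) (fun i => ?_) hlim
    rw [← WithLp.toLp_sub, ← vnorm_eq_norm_toLp]
    exact hpow i
  exact ((EuclideanSpace.equiv (Fin n) ℝ).continuous.tendsto _).comp hE

/-- Theorem 4.3 of the paper: global convergence of the SCF iteration
with simple mixing under the xc-bound assumption and uniform well-posedness (UWP). -/
theorem scf_simple_mixing_global {n p : ℕ} (hp : 1 ≤ p) (hpn : p < n)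
    (L Vion Ld : Matrix (Fin n) (Fin n) ℝ)
    (hL : L.IsHermitian) (hVion : Vion.IsHermitian)
    (hMP1 : L * Ld * L = L) (hMP2 : Ld * L * Ld = Ld)
    (hMP3 : (L * Ld)ᵀ = L * Ld) (hMP4 : (Ld * L)ᵀ = Ld * L)
    (m : (Fin n → ℝ) → (Fin n → ℝ)) (θ : ℝ)
    (hm1 : ContDiff ℝ 1 m)
    (hmθ : ∀ (ρ : Fin n → ℝ) (z : Fin n → ℝ), vnorm (fderiv ℝ m ρ z) ≤ θ * vnorm z)
    (δ : ℝ) (hδ : 0 < δ)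
    (hUWP : ∀ W : Fin n → ℝ,
      eig (Hmat L Vion W) ⟨p, hpn⟩ - eig (Hmat L Vion W) ⟨p - 1, by omega⟩ ≥ δ)
    (b1 : ℝ) (hb1def : b1 = 1 - (specNorm Ld + θ) / δ) (hb1 : 0 < b1)
    (α : ℝ) (hα0 : 0 < α) (hα : α < 2 / (2 - b1))
    (V : ℕ → Fin n → ℝ)
    (hiter : ∀ i, V (i + 1) = V i - α • (V i - potMap Ld m (Fphi p L Vion (V i)))) :
    ∃ Vstar : Fin n → ℝ,
      Vstar = potMap Ld m (Fphi p L Vion Vstar) ∧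
      Filter.Tendsto V Filter.atTop (nhds Vstar) ∧
      ∀ i, vnorm (V (i + 1) - Vstar) ≤ (|1 - α| + α * (1 - b1)) * vnorm (V i - Vstar) := by
  have hs0 : 0 ≤ specNorm Ld := norm_nonneg _
  have hθ : 0 ≤ θ := by
    have h1 : 0 < vnorm (fun _ : Fin n => (1 : ℝ)) := by
      simp [vnorm]; omega
    have h2 := (vnorm_nonneg _).trans (hmθ 0 fun _ => 1)
    exact nonneg_of_mul_nonneg_left h2 h1
  have hK : 1 - b1 = (specNorm Ld + θ) / δ := by rw [hb1def]; ring
  have hK0 : 0 ≤ 1 - b1 := by rw [hK]; positivity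
  have hT (x y : Fin n → ℝ) : vnorm (potMap Ld m (Fphi p L Vion x) - potMap Ld m (Fphi p L Vion y))
      ≤ (1 - b1) * vnorm (x - y) := by
    set a := Fphi p L Vion x with ha
    set b := Fphi p L Vion y with hb
    have hab : δ * vnorm (a - b) ≤ vnorm (x - y) :=
      gap_mul_vnorm_Fphi_sub_le (by omega) hpn hL hVion hδ hUWP x y
    have hsplit : potMap Ld m a - potMap Ld m b = Ld *ᵥ (a - b) + (m a - m b) := by
      rw [potMap, potMap, Matrix.mulVec_sub]; abel
    calc vnorm (potMap Ld m a - potMap Ld m b)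
        ≤ vnorm (Ld *ᵥ (a - b)) + vnorm (m a - m b) := by rw [hsplit]; exact vnorm_add_le _ _
      _ ≤ specNorm Ld * vnorm (a - b) + θ * vnorm (a - b) :=
          add_le_add (vnorm_mulVec_le _ _)
            (vnorm_sub_le_of_vnorm_fderiv_le (hm1.differentiable one_ne_zero) hθ hmθ a b)
      _ = (1 - b1) * (δ * vnorm (a - b)) := by rw [hK]; field_simp
      _ ≤ (1 - b1) * vnorm (x - y) := mul_le_mul_of_nonneg_left hab hK0
  obtain ⟨v, hv⟩ := exists_fixedPoint_of_vnorm_contraction hK0 (by linarith) hT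
  have hstep (i : ℕ) :
      vnorm (V (i + 1) - v) ≤ (|1 - α| + α * (1 - b1)) * vnorm (V i - v) := by
    have hsplit : V (i + 1) - v = (1 - α) • (V i - v)
        + α • (potMap Ld m (Fphi p L Vion (V i)) - potMap Ld m (Fphi p L Vion v)) := by
      rw [hiter i, ← hv]; module
    calc vnorm (V (i + 1) - v)
        ≤ |1 - α| * vnorm (V i - v) + |α| * vnorm (potMap Ld m (Fphi p L Vion (V i))
            - potMap Ld m (Fphi p L Vion v)) := by
          rw [hsplit, ← vnorm_smul, ← vnorm_smul]; exact vnorm_add_le _ _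
      _ ≤ |1 - α| * vnorm (V i - v) + α * ((1 - b1) * vnorm (V i - v)) := by
          rw [abs_of_pos hα0]
          gcongr
          exact hT _ _
      _ = (|1 - α| + α * (1 - b1)) * vnorm (V i - v) := by ring
  have hr1 : |1 - α| + α * (1 - b1) < 1 := by
    have h2 : α * (2 - b1) < 2 := (lt_div_iff₀ (by linarith)).mp hα
    rcases abs_cases (1 - α) with ⟨h, _⟩ | ⟨h, _⟩ <;> rw [h] <;> nlinarith
  exact ⟨v, hv, tendsto_of_vnorm_sub_le_geometric (by positivity) hr1 hstep, hstep⟩
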